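/- arXiv:2506.22324 — 2 statements merged into one kernel-verified Lean document; each statement's English description precedes it below -/
import Mathlib

section
/- Under the local-alternatives setup, there exist constants C > 0 and δ' > 0 such that for all 0 ≤ δκ, δβ < δ' with δβ > 0: the matrix E[w·Z·Zᵀ] is invertible, f_φ² > 0, and the relative error satisfies |f² − f_φ²| / f_φ² ≤ C·√M·(δκ + δβ). -/
open MeasureTheory Matrix ProbabilityTheory

lemma cs_aux {Ω : Type*} {mΩ : MeasurableSpace Ω} {P : Measure Ω} {f g : Ω → ℝ}
    (hf : MemLp f 2 P) (hg : MemLp g 2 P) :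
    |∫ ω, f ω * g ω ∂P| ≤ Real.sqrt (∫ ω, f ω ^ 2 ∂P) * Real.sqrt (∫ ω, g ω ^ 2 ∂P) := by
  have hp : Real.HolderConjugate 2 2 := Real.HolderConjugate.two_two
  have h1 := integral_mul_norm_le_Lp_mul_Lq (μ := P) (f := f) (g := g) hp (by simpa using hf) (by simpa using hg)
  have h2 : |∫ ω, f ω * g ω ∂P| ≤ ∫ ω, ‖f ω‖ * ‖g ω‖ ∂P := by
    refine (abs_integral_le_integral_abs).trans (le_of_eq ?_)
    simp [abs_mul]
  refine h2.trans (h1.trans (le_of_eq ?_))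
  simp [Real.sqrt_eq_rpow]

lemma mul4 {Ω : Type*} {mΩ : MeasurableSpace Ω} {P : Measure Ω} {f g : Ω → ℝ}
    (hf : MemLp f 4 P) (hg : MemLp g 4 P) : MemLp (fun ω => f ω * g ω) 2 P := by
  have : ENNReal.HolderTriple 4 4 2 := ⟨by
    rw [show (4:ENNReal) = 2 * 2 by norm_num, ENNReal.mul_inv (by simp) (by simp), ← mul_add,
      ENNReal.inv_two_add_inv_two, mul_one]⟩
  exact hg.mul' hf

lemma dot4 {Ω : Type*} {mΩ : MeasurableSpace Ω} {P : Measure Ω} {n : ℕ} {Z : Ω → Fin n → ℝ}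
    (hZ : ∀ j, MemLp (fun ω => Z ω j) 4 P) (a : Fin n → ℝ) : MemLp (fun ω => a ⬝ᵥ Z ω) 4 P := by
  unfold dotProduct
  exact memLp_finsetSum _ (fun j _ => (hZ j).const_mul (a j))

/-- normal equations -/
lemma normal_eq {Ω : Type*} {mΩ : MeasurableSpace Ω} {P : Measure Ω} {n : ℕ} {Z : Ω → Fin n → ℝ}
    {w Y : Ω → ℝ} {N : Matrix (Fin n) (Fin n) ℝ}
    (hN : N = Matrix.of fun k j => ∫ ω, w ω * Z ω k * Z ω j ∂P) (hu : IsUnit N)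
    (h1 : ∀ k j, Integrable (fun ω => w ω * Z ω k * Z ω j) P)
    (h2 : ∀ j, Integrable (fun ω => w ω * Y ω * Z ω j) P) (a : Fin n → ℝ)
    (ha : a = (fun j => ∫ ω, w ω * Y ω * Z ω j ∂P) ᵥ* N⁻¹) (j : Fin n) :
    ∫ ω, w ω * (Y ω - a ⬝ᵥ Z ω) * Z ω j ∂P = 0 := by
  have e : ∀ ω, w ω * (Y ω - a ⬝ᵥ Z ω) * Z ω j
      = w ω * Y ω * Z ω j - ∑ k, a k * (w ω * Z ω k * Z ω j) := by
    intro ω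
    simp only [dotProduct, mul_sub, sub_mul, Finset.mul_sum, Finset.sum_mul]
    congr 1
    exact Finset.sum_congr rfl fun k _ => by ring
  simp only [e]
  rw [integral_sub (h2 j) (integrable_finsetSum _ fun k _ => (h1 k j).const_mul _),
    integral_finsetSum _ (fun k _ => (h1 k j).const_mul _)]
  simp only [integral_const_mul]
  have : a ᵥ* N = (fun j => ∫ ω, w ω * Y ω * Z ω j ∂P) := by
    rw [ha, vecMul_vecMul, Matrix.nonsing_inv_mul _ ((Matrix.isUnit_iff_isUnit_det _).1 hu), vecMul_one]
  have h3 := congrFun this j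
  simp only [vecMul, dotProduct, hN, of_apply] at h3
  rw [h3, sub_self]

lemma min_aux {Ω : Type*} {mΩ : MeasurableSpace Ω} {P : Measure Ω} [IsProbabilityMeasure P] {n : ℕ}
    {Z : Ω → Fin n → ℝ} {Y : Ω → ℝ} (hZ : ∀ j, MemLp (fun ω => Z ω j) 4 P) (hY : MemLp Y 4 P)
    (a : Fin n → ℝ) (ha : ∀ j, ∫ ω, (Y ω - a ⬝ᵥ Z ω) * Z ω j ∂P = 0) (b : Fin n → ℝ) :
    ∫ ω, (Y ω - a ⬝ᵥ Z ω) ^ 2 ∂P ≤ ∫ ω, (Y ω - b ⬝ᵥ Z ω) ^ 2 ∂P := by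
  have i4 : ∀ {f g : Ω → ℝ}, MemLp f 4 P → MemLp g 4 P → Integrable (fun ω => f ω * g ω) P :=
    fun hf hg => (mul4 hf hg).integrable (by norm_num)
  have hR : ∀ c : Fin n → ℝ, MemLp (fun ω => Y ω - c ⬝ᵥ Z ω) 4 P := fun c => hY.sub (dot4 hZ c)
  have hz : ∫ ω, (Y ω - a ⬝ᵥ Z ω) * ((a - b) ⬝ᵥ Z ω) ∂P = 0 := by
    have : ∀ ω, (Y ω - a ⬝ᵥ Z ω) * ((a - b) ⬝ᵥ Z ω)
        = ∑ j, (a - b) j * ((Y ω - a ⬝ᵥ Z ω) * Z ω j) := by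
      intro ω
      conv_lhs => rw [dotProduct.eq_def (a - b), Finset.mul_sum]
      exact Finset.sum_congr rfl fun k _ => by ring
    simp only [this]
    rw [integral_finsetSum _ fun j _ => (i4 (hR a) (hZ j)).const_mul _]
    simp only [integral_const_mul]
    exact Finset.sum_eq_zero fun j _ => by rw [ha j, mul_zero]
  have I1 : Integrable (fun ω => (Y ω - a ⬝ᵥ Z ω) ^ 2) P := by
    simpa [sq] using i4 (hR a) (hR a)
  have I2 : Integrable (fun ω => (Y ω - b ⬝ᵥ Z ω) ^ 2) P := by
    simpa [sq] using i4 (hR b) (hR b)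
  have I3 : Integrable (fun ω => 2 * ((Y ω - a ⬝ᵥ Z ω) * ((a - b) ⬝ᵥ Z ω))) P :=
    (i4 (hR a) (dot4 hZ (a-b))).const_mul 2
  calc _ = ∫ ω, ((Y ω - a ⬝ᵥ Z ω) ^ 2 + 2 * ((Y ω - a ⬝ᵥ Z ω) * ((a - b) ⬝ᵥ Z ω))) ∂P := by
        rw [integral_add I1 I3, integral_const_mul, hz]; simp
    _ ≤ _ := by
        refine integral_mono (I1.add I3) I2 fun ω => ?_
        simp only [sub_dotProduct]
        nlinarith [sq_nonneg (a ⬝ᵥ Z ω - b ⬝ᵥ Z ω)]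

lemma wint {Ω : Type*} {mΩ : MeasurableSpace Ω} {P : Measure Ω} [IsProbabilityMeasure P]
    {w f : Ω → ℝ} {c : ℝ} (hw : MemLp (fun ω => w ω - c) 2 P) (hf : MemLp f 2 P) :
    Integrable (fun ω => w ω * f ω) P ∧
    ∫ ω, w ω * f ω ∂P = ∫ ω, (w ω - c) * f ω ∂P + c * ∫ ω, f ω ∂P := by
  have i1 : Integrable (fun ω => (w ω - c) * f ω) P := hw.integrable_mul hf
  have i2 := (hf.integrable (by norm_num)).const_mul c
  have e : (fun ω => w ω * f ω) = fun ω => (w ω - c) * f ω + c * f ω := by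
    funext ω; ring
  rw [e]
  exact ⟨i1.add i2, by rw [integral_add i1 i2, integral_const_mul]⟩

lemma core {Ω : Type*} {mΩ : MeasurableSpace Ω} {P : Measure Ω} [IsProbabilityMeasure P]
    {w R G : Ω → ℝ} {ws s S d v : ℝ} (hws : 0 < ws) (hs : 0 ≤ s) (hsS : s ≤ S) (hd : 0 < d) (hv : 0 < v)
    (hw : MemLp (fun ω => w ω - ws) 2 P) (hws2 : ∫ ω, (w ω - ws) ^ 2 ∂P ≤ s ^ 2)
    (hR : MemLp R 4 P) (hG : MemLp G 4 P) (hRG : ∀ ω, |R ω| ≤ G ω)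
    (hort : ∫ ω, w ω * R ω ∂P = 0) (hvar : v ≤ variance R P) :
    0 < ws * variance (fun ω => d * R ω) P ∧
    |∫ ω, w ω * (d * R ω) ^ 2 ∂P - ws * variance (fun ω => d * R ω) P|
      / (ws * variance (fun ω => d * R ω) P)
      ≤ (Real.sqrt (∫ ω, (G ω ^ 2) ^ 2 ∂P) + S * (∫ ω, G ω ^ 2 ∂P) / ws) / (ws * v) * s := by
  have hR2 : MemLp R 2 P := hR.mono_exponent (by norm_num)
  have hG2 : MemLp G 2 P := hG.mono_exponent (by norm_num)
  have hRR : MemLp (fun ω => R ω ^ 2) 2 P := by simpa [sq] using mul4 hR hR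
  have hGG : MemLp (fun ω => G ω ^ 2) 2 P := by simpa [sq] using mul4 hG hG
  have hsq : Real.sqrt (∫ ω, (w ω - ws) ^ 2 ∂P) ≤ s := Real.sqrt_le_iff.2 ⟨hs, hws2⟩
  have hle : ∀ ω, R ω ^ 2 ≤ G ω ^ 2 := fun ω => sq_le_sq' (by linarith [(abs_le.1 (hRG ω)).1]) (abs_le.1 (hRG ω)).2
  have k2 : ∫ ω, R ω ^ 2 ∂P ≤ ∫ ω, G ω ^ 2 ∂P := integral_mono hR2.integrable_sq hG2.integrable_sq hle
  have k4 : ∫ ω, (R ω ^ 2) ^ 2 ∂P ≤ ∫ ω, (G ω ^ 2) ^ 2 ∂P :=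
    integral_mono hRR.integrable_sq hGG.integrable_sq fun ω => by
      have := hle ω; have := sq_nonneg (R ω); dsimp only; gcongr
  obtain ⟨-, e1⟩ := wint hw hR2
  obtain ⟨-, e2⟩ := wint hw hRR
  have b1 := cs_aux hw hR2
  have b2 := cs_aux hw hRR
  set m := ∫ ω, R ω ∂P
  set x1 := ∫ ω, (w ω - ws) * R ω ∂P
  set x2 := ∫ ω, (w ω - ws) * R ω ^ 2 ∂P
  have b1' : |x1| ≤ s * Real.sqrt (∫ ω, G ω ^ 2 ∂P) := b1.trans (by gcongr)
  have b2' : |x2| ≤ s * Real.sqrt (∫ ω, (G ω ^ 2) ^ 2 ∂P) := b2.trans (by gcongr)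
  have hG0 : 0 ≤ ∫ ω, G ω ^ 2 ∂P := integral_nonneg fun ω => sq_nonneg _
  have b1s : x1 ^ 2 ≤ s ^ 2 * ∫ ω, G ω ^ 2 ∂P := by
    calc x1 ^ 2 = |x1| ^ 2 := (sq_abs _).symm
      _ ≤ (s * Real.sqrt (∫ ω, G ω ^ 2 ∂P)) ^ 2 := by gcongr
      _ = _ := by rw [mul_pow, Real.sq_sqrt hG0]
  have hm : ws * m = - x1 := by linarith
  have hmm : ws * m ^ 2 ≤ s * (S * (∫ ω, G ω ^ 2 ∂P) / ws) := by
    have : ws * m ^ 2 = x1 ^ 2 / ws := by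
      field_simp
      rw [← neg_sq x1, ← hm]; ring
    rw [this, ← mul_div_assoc]
    gcongr
    refine b1s.trans ?_
    rw [sq, mul_assoc]
    gcongr
  have hV : variance R P = ∫ ω, R ω ^ 2 ∂P - m ^ 2 := by
    rw [variance_eq_sub hR2]; rfl
  have hVd : variance (fun ω => d * R ω) P = d ^ 2 * variance R P := variance_const_mul d R P
  have hf : ∫ ω, w ω * (d * R ω) ^ 2 ∂P = d ^ 2 * ∫ ω, w ω * R ω ^ 2 ∂P := by
    rw [← integral_const_mul]; congr 1; funext ω; ring
  have hvp : 0 < variance R P := hv.trans_le hvar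
  have hpos : 0 < ws * variance (fun ω => d * R ω) P := by rw [hVd]; positivity
  refine ⟨hpos, ?_⟩
  have hnum : ∫ ω, w ω * (d * R ω) ^ 2 ∂P - ws * variance (fun ω => d * R ω) P
      = d ^ 2 * (x2 + ws * m ^ 2) := by
    rw [hf, hVd, e2, hV]; ring
  rw [hnum, hVd, abs_mul, abs_of_pos (by positivity : 0 < d ^ 2),
    show ws * (d ^ 2 * variance R P) = d ^ 2 * (ws * variance R P) by ring,
    mul_div_mul_left _ _ (by positivity), div_mul_eq_mul_div]
  have hn : |x2 + ws * m ^ 2| ≤ (Real.sqrt (∫ ω, (G ω ^ 2) ^ 2 ∂P) + S * (∫ ω, G ω ^ 2 ∂P) / ws) * s := by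
    refine (abs_add_le _ _).trans ?_
    rw [abs_of_nonneg (by positivity : 0 ≤ ws * m ^ 2)]
    linarith
  have := (abs_nonneg _).trans hn
  gcongr

lemma coord4 {Ω : Type*} {mΩ : MeasurableSpace Ω} {P : Measure Ω} {n : ℕ} {Z : Ω → Fin n → ℝ}
    (hm : Measurable Z) (hi : Integrable (fun ω => Real.sqrt (∑ k, Z ω k ^ 2) ^ 4) P) (j : Fin n) :
    MemLp (fun ω => Z ω j) 4 P := by
  have hmj : ∀ k, Measurable fun ω => Z ω k := fun k => (measurable_pi_apply k).comp hm
  have hmS : Measurable fun ω => Real.sqrt (∑ k, Z ω k ^ 2) :=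
    (Finset.measurable_sum _ fun k _ => (hmj k).pow_const 2).sqrt
  have h4 : MemLp (fun ω => Real.sqrt (∑ k, Z ω k ^ 2)) 4 P := by
    rw [← integrable_norm_rpow_iff hmS.aestronglyMeasurable (by norm_num) (by norm_num)]
    refine hi.congr (Filter.Eventually.of_forall fun ω => ?_)
    simp only [Real.norm_eq_abs, abs_of_nonneg (Real.sqrt_nonneg _)]
    rw [show (4 : ENNReal).toReal = ((4 : ℕ) : ℝ) by norm_num, Real.rpow_natCast]
  refine h4.of_le (hmj j).aestronglyMeasurable (Filter.Eventually.of_forall fun ω => ?_)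
  rw [Real.norm_eq_abs, Real.norm_eq_abs, abs_of_nonneg (Real.sqrt_nonneg _), ← Real.sqrt_sq_eq_abs]
  exact Real.sqrt_le_sqrt (Finset.single_le_sum (f := fun k => Z ω k ^ 2) (fun k _ => sq_nonneg _) (Finset.mem_univ j))

lemma tend_aux {Ω T : Type*} {mΩ : MeasurableSpace Ω} {P : Measure Ω} [IsProbabilityMeasure P]
    {l : Filter T} {W : T → Ω → ℝ} {s : T → ℝ} {ws : ℝ} (hs : Filter.Tendsto s l (nhds 0))
    (hW : ∀ᶠ x in l, 0 ≤ s x ∧ MemLp (fun ω => W x ω - ws) 2 P ∧ ∫ ω, (W x ω - ws) ^ 2 ∂P ≤ s x ^ 2)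
    {f : Ω → ℝ} (hf : MemLp f 2 P) :
    Filter.Tendsto (fun x => ∫ ω, W x ω * f ω ∂P) l (nhds (∫ ω, ws * f ω ∂P)) := by
  rw [tendsto_iff_norm_sub_tendsto_zero]
  refine squeeze_zero_norm' (a := fun x => s x * Real.sqrt (∫ ω, f ω ^ 2 ∂P)) ?_ (by simpa using hs.mul_const (Real.sqrt (∫ ω, f ω ^ 2 ∂P)))
  filter_upwards [hW] with x ⟨h0, h1, h2⟩
  rw [norm_norm, (wint h1 hf).2, integral_const_mul, add_sub_cancel_right, Real.norm_eq_abs]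
  exact (cs_aux h1 hf).trans (mul_le_mul_of_nonneg_right (Real.sqrt_le_iff.2 ⟨h0, h2⟩) (Real.sqrt_nonneg _))

lemma inv_tend {T : Type*} {n : ℕ} {l : Filter T} {N : T → Matrix (Fin n) (Fin n) ℝ}
    {Ns : Matrix (Fin n) (Fin n) ℝ} (hu : IsUnit Ns) (hN : Filter.Tendsto N l (nhds Ns)) :
    (∀ᶠ x in l, IsUnit (N x)) ∧ Filter.Tendsto (fun x => (N x)⁻¹) l (nhds Ns⁻¹) := by
  have hd : Ns.det ≠ 0 := ((Matrix.isUnit_iff_isUnit_det _).1 hu).ne_zero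
  have hdt : Filter.Tendsto (fun x => (N x).det) l (nhds Ns.det) :=
    ((continuous_id.matrix_det).tendsto Ns).comp hN
  have hat : Filter.Tendsto (fun x => (N x).adjugate) l (nhds Ns.adjugate) :=
    ((continuous_id.matrix_adjugate).tendsto Ns).comp hN
  constructor
  · filter_upwards [hdt.eventually_ne hd] with x hx
    exact (Matrix.isUnit_iff_isUnit_det _).2 (isUnit_iff_ne_zero.2 hx)
  · simp only [Matrix.inv_def, Ring.inverse_eq_inv']
    exact (hdt.inv₀ hd).smul hat

/-- **Theorem 1 of the paper.** Under the local-alternatives setup, there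
exist constants `C > 0` and `δ' > 0` such that for all `0 ≤ δκ, δβ < δ'` with `δβ > 0`:
the matrix `E[w·Z·Zᵀ]` is invertible, `f_φ² > 0`, and the relative error satisfies
`|f² − f_φ²| / f_φ² ≤ C·√M·(δκ + δβ)`. -/
theorem relative_error_phi
    {Ω : Type*} {mΩ : MeasurableSpace Ω} (P : Measure Ω) [IsProbabilityMeasure P]
    {p q : ℕ} (X : Ω → Fin p → ℝ) (Z0 : Ω → Fin q → ℝ)
    (hX_meas : Measurable X) (hZ0_meas : Measurable Z0)
    -- Z = (1, Z₀)
    (Z : Ω → Fin (q + 1) → ℝ) (hZ : ∀ ω, Z ω = Fin.cons 1 (Z0 ω))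
    (μs : ℝ) (κs : Fin q → ℝ) (βs : Fin p → ℝ)
    -- inverse link and variance function
    (h V : ℝ → ℝ) (hh : ContDiff ℝ 1 h) (hV_cont : Continuous V)
    (hV_pos : ∀ t, 0 < V t)
    -- linear predictor and weight, as functions of (ι, δκ, δβ)
    (η : ℝ → ℝ → ℝ → Ω → ℝ)
    (hη_def : ∀ i dκ dβ ω, η i dκ dβ ω = i + dκ * (κs ⬝ᵥ Z0 ω) + dβ * (βs ⬝ᵥ X ω))
    (w : ℝ → ℝ → ℝ → Ω → ℝ)
    (hw_def : ∀ i dκ dβ ω, w i dκ dβ ω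
      = (deriv h (η i dκ dβ ω)) ^ 2 / V (h (η i dκ dβ ω)))
    (ηs : ℝ) (hηs : h ηs = μs)
    (ws : ℝ) (hws : ws = (deriv h ηs) ^ 2 / V μs)
    -- bounded moments up to fourth order
    (hmom : ∀ i j : ℕ, 1 ≤ i + j → i + j ≤ 4 → Integrable (fun ω =>
      Real.sqrt (∑ k, X ω k ^ 2) ^ i * Real.sqrt (∑ k, Z ω k ^ 2) ^ j) P)
    -- regularity
    (hws_ne : ws ≠ 0)
    (Mzzs : Matrix (Fin (q + 1)) (Fin (q + 1)) ℝ)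
    (hMzzs : Mzzs = Matrix.of fun i j => ∫ ω, ws * Z ω i * Z ω j ∂P)
    (hMzzs_inv : IsUnit Mzzs)
    (As : Matrix (Fin p) (Fin (q + 1)) ℝ)
    (hAs : As = (Matrix.of fun i j => ∫ ω, ws * X ω i * Z ω j ∂P) * Mzzs⁻¹)
    (hreg : 0 < ∫ ω, ws * (βs ⬝ᵥ (X ω - As *ᵥ Z ω)) ^ 2 ∂P)
    -- mean constraint
    (ι : ℝ → ℝ → ℝ) (δ₀ : ℝ) (hδ₀ : 0 < δ₀)
    (hmean : ∀ dκ dβ : ℝ, 0 ≤ dκ → dκ < δ₀ → 0 ≤ dβ → dβ < δ₀ →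
      ∫ ω, h (η (ι dκ dβ) dκ dβ ω) ∂P = μs)
    -- smoothness of w
    (M δstar : ℝ) (hM : 0 ≤ M) (hδstar : 0 < δstar)
    (hsmooth : ∀ dκ dβ : ℝ, 0 ≤ dκ → dκ < δstar → 0 ≤ dβ → dβ < δstar →
      Integrable (fun ω => (w (ι dκ dβ) dκ dβ ω - ws) ^ 2) P ∧
      ∫ ω, (w (ι dκ dβ) dκ dβ ω - ws) ^ 2 ∂P ≤ M * (dκ + dβ) ^ 2)
    -- derived quantities (for parameter values where E[w·Z·Zᵀ] is invertible)
    (Mzz : ℝ → ℝ → ℝ → Matrix (Fin (q + 1)) (Fin (q + 1)) ℝ)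
    (hMzz : ∀ i dκ dβ, Mzz i dκ dβ
      = Matrix.of fun k j => ∫ ω, w i dκ dβ ω * Z ω k * Z ω j ∂P)
    (A : ℝ → ℝ → ℝ → Matrix (Fin p) (Fin (q + 1)) ℝ)
    (hA : ∀ i dκ dβ, A i dκ dβ
      = (Matrix.of fun k j => ∫ ω, w i dκ dβ ω * X ω k * Z ω j ∂P) * (Mzz i dκ dβ)⁻¹)
    (ηz : ℝ → ℝ → ℝ → Ω → ℝ)
    (hηz : ∀ i dκ dβ ω, ηz i dκ dβ ω
      = (fun j => ∫ ω', w i dκ dβ ω' * η i dκ dβ ω' * Z ω' j ∂P)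
          ⬝ᵥ ((Mzz i dκ dβ)⁻¹ *ᵥ Z ω))
    (fsq : ℝ → ℝ → ℝ → ℝ)
    (hfsq : ∀ i dκ dβ, fsq i dκ dβ
      = ∫ ω, w i dκ dβ ω * (η i dκ dβ ω - ηz i dκ dβ ω) ^ 2 ∂P)
    (fφsq : ℝ → ℝ → ℝ → ℝ)
    (hfφsq : ∀ i dκ dβ, fφsq i dκ dβ
      = ws * variance (fun ω => η i dκ dβ ω - ηz i dκ dβ ω) P)
    :
    ∃ C > (0 : ℝ), ∃ δ' > (0 : ℝ), ∀ dκ dβ : ℝ, 0 ≤ dκ → dκ < δ' → 0 ≤ dβ → dβ < δ' →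
      0 < dβ →
      IsUnit (Mzz (ι dκ dβ) dκ dβ) ∧
      0 < fφsq (ι dκ dβ) dκ dβ ∧
      |fsq (ι dκ dβ) dκ dβ - fφsq (ι dκ dβ) dκ dβ| / fφsq (ι dκ dβ) dκ dβ
        ≤ C * Real.sqrt M * (dκ + dβ) := by
  have hV0 : 0 ≤ ws := by rw [hws]; exact div_nonneg (sq_nonneg _) (hV_pos _).le
  have hws0 : 0 < ws := lt_of_le_of_ne hV0 (Ne.symm hws_ne)
  have hZ_meas : Measurable Z := by
    rw [measurable_pi_iff]
    intro j
    refine Fin.cases ?_ (fun k => ?_) j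
    · simp [hZ]
    · simp only [hZ, Fin.cons_succ]; exact (measurable_pi_apply k).comp hZ0_meas
  have hX4 : ∀ k, MemLp (fun ω => X ω k) 4 P :=
    coord4 hX_meas (by simpa using hmom 4 0 (by norm_num) (by norm_num))
  have hZ4 : ∀ k, MemLp (fun ω => Z ω k) 4 P :=
    coord4 hZ_meas (by simpa using hmom 0 4 (by norm_num) (by norm_num))
  have hZ00 : ∀ ω, Z ω 0 = 1 := fun ω => by simp [hZ]
  set Y : Ω → ℝ := fun ω => βs ⬝ᵥ X ω with hYdef
  have hY4 : MemLp Y 4 P := dot4 hX4 βs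
  have hZZ : ∀ k j, MemLp (fun ω => Z ω k * Z ω j) 2 P := fun k j => mul4 (hZ4 k) (hZ4 j)
  have hYZ : ∀ j, MemLp (fun ω => Y ω * Z ω j) 2 P := fun j => mul4 hY4 (hZ4 j)
  have hXZ : ∀ k j, MemLp (fun ω => X ω k * Z ω j) 2 P := fun k j => mul4 (hX4 k) (hZ4 j)
  have hR4 : ∀ c : Fin (q+1) → ℝ, MemLp (fun ω => Y ω - c ⬝ᵥ Z ω) 4 P :=
    fun c => hY4.sub (dot4 hZ4 c)
  -- limit coefficient
  set bs : Fin (q+1) → ℝ := fun j => ∫ ω, ws * Y ω * Z ω j ∂P with hbs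
  set as : Fin (q+1) → ℝ := bs ᵥ* Mzzs⁻¹ with has
  have hAas : βs ᵥ* As = as := by
    rw [hAs, ← vecMul_vecMul, has]
    congr 1
    funext j
    simp only [vecMul, dotProduct, of_apply, hbs, hYdef]
    rw [← Finset.sum_congr rfl fun k _ => integral_const_mul (βs k) _, ← integral_finsetSum]
    · congr 1
      funext ω
      rw [Finset.mul_sum, Finset.sum_mul]
      exact Finset.sum_congr rfl fun k _ => by ring
    · intro k _
      have := (((hXZ k j).integrable (by norm_num)).const_mul ws).const_mul (βs k)
      simpa only [mul_assoc] using this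
  have horts : ∀ j, ∫ ω, (Y ω - as ⬝ᵥ Z ω) * Z ω j ∂P = 0 := by
    intro j
    have h1 := normal_eq (w := fun _ => ws) (Y := Y) hMzzs hMzzs_inv
      (fun k j => by simpa only [mul_assoc] using ((hZZ k j).integrable (by norm_num)).const_mul ws)
      (fun j => by simpa only [mul_assoc] using ((hYZ j).integrable (by norm_num)).const_mul ws) as has j
    simp only [mul_assoc, integral_const_mul] at h1
    exact (mul_eq_zero.1 h1).resolve_left hws_ne
  set v : ℝ := ∫ ω, (Y ω - as ⬝ᵥ Z ω) ^ 2 ∂P with hvdef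
  have hv : 0 < v := by
    rw [integral_const_mul] at hreg
    have h1 := (mul_pos_iff_of_pos_left hws0).1 hreg
    simp only [dotProduct_sub, dotProduct_mulVec, hAas] at h1
    exact h1
  have hvar : ∀ c : Fin (q+1) → ℝ, v ≤ variance (fun ω => Y ω - c ⬝ᵥ Z ω) P := by
    intro c
    rw [variance_eq_integral (hR4 c).1.aemeasurable]
    set m := ∫ ω, (Y ω - c ⬝ᵥ Z ω) ∂P
    refine (min_aux hZ4 hY4 as horts (c + Pi.single 0 m)).trans (le_of_eq ?_)
    congr 1
    funext ω
    rw [add_dotProduct, single_dotProduct, hZ00]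
    ring
  -- filter
  let l : Filter (ℝ × ℝ) := nhdsWithin 0 {x | 0 ≤ x.1 ∧ 0 ≤ x.2}
  let W : ℝ × ℝ → Ω → ℝ := fun x => w (ι x.1 x.2) x.1 x.2
  let s : ℝ × ℝ → ℝ := fun x => Real.sqrt M * (x.1 + x.2)
  have hwm : ∀ i a b, Measurable (w i a b) := by
    intro i a b
    have e : w i a b = fun ω => (deriv h (η i a b ω)) ^ 2 / V (h (η i a b ω)) := funext (hw_def i a b)
    have hηm : Measurable (η i a b) := by
      have e : η i a b = fun ω => i + a * (κs ⬝ᵥ Z0 ω) + b * (βs ⬝ᵥ X ω) := funext (hη_def i a b)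
      rw [e]
      unfold dotProduct
      fun_prop
    rw [e]
    have h1 : Continuous (deriv h) := hh.continuous_deriv le_rfl
    exact ((h1.measurable.comp hηm).pow_const 2).div
      (hV_cont.measurable.comp (hh.continuous.measurable.comp hηm))
  have hgood : ∀ x : ℝ × ℝ, 0 ≤ x.1 → x.1 < δstar → 0 ≤ x.2 → x.2 < δstar →
      0 ≤ s x ∧ MemLp (fun ω => W x ω - ws) 2 P ∧ ∫ ω, (W x ω - ws) ^ 2 ∂P ≤ s x ^ 2 := by
    intro x h1 h2 h3 h4
    obtain ⟨a1, a2⟩ := hsmooth x.1 x.2 h1 h2 h3 h4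
    refine ⟨by positivity, ?_, ?_⟩
    · exact (memLp_two_iff_integrable_sq ((hwm _ _ _).sub_const ws).aestronglyMeasurable).2 a1
    · simp only [s, mul_pow, Real.sq_sqrt hM]; exact a2
  have hs0 : Filter.Tendsto s l (nhds 0) := by
    have : Continuous s := by fun_prop
    have h1 := (this.tendsto 0).mono_left (nhdsWithin_le_nhds (s := {x : ℝ × ℝ | 0 ≤ x.1 ∧ 0 ≤ x.2}))
    simpa [s] using h1
  have hlt : ∀ r : ℝ, 0 < r → ∀ᶠ x in l, (0 ≤ x.1 ∧ x.1 < r) ∧ (0 ≤ x.2 ∧ x.2 < r) := by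
    intro r hr
    have h1 : ∀ᶠ x : ℝ × ℝ in nhds 0, x.1 < r :=
      continuous_fst.continuousAt.eventually_lt continuousAt_const (by simpa using hr)
    have h2 : ∀ᶠ x : ℝ × ℝ in nhds 0, x.2 < r :=
      continuous_snd.continuousAt.eventually_lt continuousAt_const (by simpa using hr)
    filter_upwards [self_mem_nhdsWithin, nhdsWithin_le_nhds h1, nhdsWithin_le_nhds h2] with x a b c
    exact ⟨⟨a.1, b⟩, ⟨a.2, c⟩⟩
  have hW : ∀ᶠ x in l, 0 ≤ s x ∧ MemLp (fun ω => W x ω - ws) 2 P ∧ ∫ ω, (W x ω - ws) ^ 2 ∂P ≤ s x ^ 2 := by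
    filter_upwards [hlt δstar hδstar] with x hx
    exact hgood x hx.1.1 hx.1.2 hx.2.1 hx.2.2
  let N : ℝ × ℝ → Matrix (Fin (q+1)) (Fin (q+1)) ℝ := fun x => Mzz (ι x.1 x.2) x.1 x.2
  have hN : ∀ x, N x = Matrix.of fun k j => ∫ ω, W x ω * Z ω k * Z ω j ∂P := fun x => hMzz _ _ _
  let b : ℝ × ℝ → Fin (q+1) → ℝ := fun x j => ∫ ω, W x ω * Y ω * Z ω j ∂P
  let a : ℝ × ℝ → Fin (q+1) → ℝ := fun x => b x ᵥ* (N x)⁻¹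
  have hNt : Filter.Tendsto N l (nhds Mzzs) := by
    refine tendsto_pi_nhds.2 fun k => tendsto_pi_nhds.2 fun j => ?_
    simp only [hN, hMzzs, of_apply, mul_assoc]
    exact tend_aux hs0 hW (hZZ k j)
  have hbt : Filter.Tendsto b l (nhds bs) := by
    rw [tendsto_pi_nhds]; intro j
    simp only [b, hbs, mul_assoc]
    exact tend_aux hs0 hW (hYZ j)
  obtain ⟨hNu, hNi⟩ := inv_tend hMzzs_inv hNt
  have hat : Filter.Tendsto a l (nhds as) := by
    have hc : Continuous fun y : (Fin (q+1) → ℝ) × Matrix (Fin (q+1)) (Fin (q+1)) ℝ => y.1 ᵥ* y.2 :=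
      continuous_fst.matrix_vecMul continuous_snd
    exact (hc.tendsto (bs, Mzzs⁻¹)).comp (hbt.prodMk_nhds hNi)
  set K : ℝ := ‖as‖ + 1 with hK
  have hK0 : 0 ≤ K := by positivity
  have haK : ∀ᶠ x in l, ‖a x‖ < K := hat.norm.eventually_lt_const (by simp [hK])
  let G : Ω → ℝ := fun ω => |Y ω| + K * ∑ j, |Z ω j|
  have hG4 : MemLp G 4 P := by
    have := memLp_finsetSum (Finset.univ) (fun j _ => (hZ4 j).abs)
    exact hY4.abs.add (this.const_mul K)
  obtain ⟨δ, hδ, hball⟩ := Metric.mem_nhdsWithin_iff.1 (hNu.and haK)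
  set C0 : ℝ := (Real.sqrt (∫ ω, (G ω ^ 2) ^ 2 ∂P) + (Real.sqrt M * 2) * (∫ ω, G ω ^ 2 ∂P) / ws) / (ws * v) with hC0
  have hC0n : 0 ≤ C0 := by
    have : 0 ≤ ∫ ω, G ω ^ 2 ∂P := integral_nonneg fun ω => sq_nonneg _
    positivity
  refine ⟨C0 + 1, by positivity, min 1 (min δ δstar), by positivity, ?_⟩
  intro dκ dβ h1 h2 h3 h4 h5
  simp only [lt_min_iff] at h2 h4
  have hx : (dκ, dβ) ∈ Metric.ball (0 : ℝ × ℝ) δ ∩ {x | 0 ≤ x.1 ∧ 0 ≤ x.2} := by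
    refine ⟨?_, h1, h3⟩
    rw [mem_ball_zero_iff, Prod.norm_mk, max_lt_iff, Real.norm_of_nonneg h1, Real.norm_of_nonneg h3]
    exact ⟨h2.2.1, h4.2.1⟩
  obtain ⟨hu, ha⟩ := hball hx
  obtain ⟨g0, g1, g2⟩ := hgood (dκ, dβ) h1 h2.2.2 h3 h4.2.2
  set x : ℝ × ℝ := (dκ, dβ) with hxdef
  have iZZ : ∀ k j, Integrable (fun ω => W x ω * Z ω k * Z ω j) P := fun k j => by
    simpa only [mul_assoc] using (wint g1 (hZZ k j)).1
  have iYZ : ∀ j, Integrable (fun ω => W x ω * Y ω * Z ω j) P := fun j => by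
    simpa only [mul_assoc] using (wint g1 (hYZ j)).1
  have hort := normal_eq (hN x) hu iZZ iYZ (a x) rfl 0
  simp only [hZ00, mul_one] at hort
  -- residual identity
  have hres : ∀ ω, η (ι dκ dβ) dκ dβ ω - ηz (ι dκ dβ) dκ dβ ω = dβ * (Y ω - a x ⬝ᵥ Z ω) := by
    intro ω
    let c : Fin (q+1) → ℝ := Fin.cons (ι dκ dβ) (dκ • κs)
    have hηc : ∀ ω, η (ι dκ dβ) dκ dβ ω = c ⬝ᵥ Z ω + dβ * Y ω := by
      intro ω
      rw [hη_def, hZ]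
      simp [c, dotProduct, Fin.sum_univ_succ, Finset.mul_sum, hYdef, mul_assoc]
    have hvec : (fun j => ∫ ω', w (ι dκ dβ) dκ dβ ω' * η (ι dκ dβ) dκ dβ ω' * Z ω' j ∂P)
        = c ᵥ* N x + dβ • b x := by
      funext j
      have e : ∀ ω', w (ι dκ dβ) dκ dβ ω' * η (ι dκ dβ) dκ dβ ω' * Z ω' j
          = ∑ k, c k * (W x ω' * Z ω' k * Z ω' j) + dβ * (W x ω' * Y ω' * Z ω' j) := by
        intro ω'
        rw [hηc, dotProduct, mul_add, add_mul, Finset.mul_sum, Finset.sum_mul]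
        congr 1
        · exact Finset.sum_congr rfl fun k _ => by simp only [W, x]; ring
        · simp only [W, x]; ring
      simp only [e]
      rw [integral_add (integrable_finsetSum _ fun k _ => (iZZ k j).const_mul _) ((iYZ j).const_mul _),
        integral_finsetSum _ fun k _ => (iZZ k j).const_mul _]
      simp only [integral_const_mul, Pi.add_apply, Pi.smul_apply, smul_eq_mul, vecMul, dotProduct, hN, of_apply, b]
    have hzz : ηz (ι dκ dβ) dκ dβ ω = c ⬝ᵥ Z ω + dβ * (a x ⬝ᵥ Z ω) := by
      rw [hηz, hvec, dotProduct_mulVec]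
      change (c ᵥ* N x + dβ • b x) ᵥ* (N x)⁻¹ ⬝ᵥ Z ω = _
      rw [add_vecMul, vecMul_vecMul, Matrix.mul_nonsing_inv _ ((Matrix.isUnit_iff_isUnit_det _).1 hu),
        vecMul_one, smul_vecMul, add_dotProduct, smul_dotProduct, smul_eq_mul]
    rw [hηc, hzz]; ring
  have hRG : ∀ ω, |Y ω - a x ⬝ᵥ Z ω| ≤ G ω := by
    intro ω
    refine (abs_sub _ _).trans ?_
    refine add_le_add le_rfl ?_
    rw [dotProduct, Finset.mul_sum]
    refine (Finset.abs_sum_le_sum_abs _ _).trans (Finset.sum_le_sum fun j _ => ?_)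
    rw [abs_mul]
    exact mul_le_mul_of_nonneg_right ((norm_le_pi_norm (a x) j).trans ha.le) (abs_nonneg _)
  have hsS : s x ≤ Real.sqrt M * 2 := by
    simp only [s, x]
    exact mul_le_mul_of_nonneg_left (by linarith) (Real.sqrt_nonneg _)
  obtain ⟨r1, r2⟩ := core hws0 g0 hsS h5 hv g1 g2 (hR4 (a x)) hG4 hRG hort (hvar (a x))
  refine ⟨hu, ?_, ?_⟩
  · rw [hfφsq]; simp only [hres]; exact r1
  · rw [hfφsq, hfsq]; simp only [hres]
    refine r2.trans ?_
    have h6 : C0 * s x ≤ (C0 + 1) * s x := mul_le_mul_of_nonneg_right (by linarith) g0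
    exact h6.trans (le_of_eq (mul_assoc _ _ _).symm)
end

section
/- Under the local-alternatives setup with the smoothness-of-μ assumption, there exist constants C > 0 and δ' > 0 such that for all 0 ≤ δκ, δβ < δ' with δβ > 0: the matrix E[w·Z·Zᵀ] is invertible, f_R² > 0, and the relative error satisfies |f² − f_R²| / f_R² ≤ C·√K·δβ. -/
open MeasureTheory Matrix ProbabilityTheory

lemma aux_cs {Ω : Type*} {mΩ : MeasurableSpace Ω} (P : Measure Ω) {f g : Ω → ℝ}
    (hf : MemLp f 2 P) (hg : MemLp g 2 P) :
    |∫ ω, f ω * g ω ∂P| ≤ Real.sqrt (∫ ω, f ω ^ 2 ∂P) * Real.sqrt (∫ ω, g ω ^ 2 ∂P) := by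
  have hfg : Integrable (fun ω => f ω * g ω) P := hf.integrable_mul hg
  have key : ∀ x : ℝ, 0 ≤ (∫ ω, f ω ^ 2 ∂P) * (x * x) + (2 * ∫ ω, f ω * g ω ∂P) * x
      + ∫ ω, g ω ^ 2 ∂P := by
    intro x
    have : (∫ ω, f ω ^ 2 ∂P) * (x * x) + (2 * ∫ ω, f ω * g ω ∂P) * x
      + ∫ ω, g ω ^ 2 ∂P = ∫ ω, (x * f ω + g ω) ^ 2 ∂P := by
      have e : (fun ω => (x * f ω + g ω) ^ 2)
          = fun ω => (x * x * f ω ^ 2 + (2 * x) * (f ω * g ω)) + g ω ^ 2 := by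
        funext ω; ring
      have j1 : Integrable (fun ω => x * x * f ω ^ 2 + (2 * x) * (f ω * g ω)) P :=
        (hf.integrable_sq.const_mul _).add (hfg.const_mul _)
      rw [e, integral_add j1 hg.integrable_sq,
        integral_add (hf.integrable_sq.const_mul _) (hfg.const_mul _),
        integral_const_mul, integral_const_mul]
      ring
    rw [this]
    exact integral_nonneg fun ω => sq_nonneg _
  have hd := discrim_le_zero key
  unfold discrim at hd
  rw [← Real.sqrt_mul (integral_nonneg fun ω => sq_nonneg _)]
  apply Real.abs_le_sqrt
  nlinarith

lemma aux_quad {Ω : Type*} {mΩ : MeasurableSpace Ω} (P : Measure Ω) {n : ℕ}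
    {w u : Ω → ℝ} {Z : Ω → Fin n → ℝ}
    (hw : MemLp w 2 P) (huu : MemLp (fun ω => u ω * u ω) 2 P)
    (huZ : ∀ j, MemLp (fun ω => u ω * Z ω j) 2 P)
    (hZZ : ∀ i j, MemLp (fun ω => Z ω i * Z ω j) 2 P) (a : Fin n → ℝ) :
    Integrable (fun ω => w ω * (u ω - a ⬝ᵥ Z ω) ^ 2) P ∧
    ∫ ω, w ω * (u ω - a ⬝ᵥ Z ω) ^ 2 ∂P
      = (∫ ω, w ω * (u ω * u ω) ∂P) - 2 * (∑ j, a j * ∫ ω, w ω * (u ω * Z ω j) ∂P)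
        + ∑ i, ∑ j, a i * a j * ∫ ω, w ω * (Z ω i * Z ω j) ∂P := by
  have i1 : Integrable (fun ω => w ω * (u ω * u ω)) P := hw.integrable_mul huu
  have i2 : ∀ j, Integrable (fun ω => w ω * (u ω * Z ω j)) P := fun j => hw.integrable_mul (huZ j)
  have i3 : ∀ i j, Integrable (fun ω => w ω * (Z ω i * Z ω j)) P :=
    fun i j => hw.integrable_mul (hZZ i j)
  have s2 : Integrable (fun ω => ∑ j, a j * (w ω * (u ω * Z ω j))) P :=
    integrable_finsetSum _ fun j _ => (i2 j).const_mul _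
  have s3' : ∀ i, Integrable (fun ω => ∑ j, a i * a j * (w ω * (Z ω i * Z ω j))) P := fun i =>
    integrable_finsetSum _ fun j _ => (i3 i j).const_mul _
  have s3 : Integrable (fun ω => ∑ i, ∑ j, a i * a j * (w ω * (Z ω i * Z ω j))) P :=
    integrable_finsetSum _ fun i _ => s3' i
  have e : (fun ω => w ω * (u ω - a ⬝ᵥ Z ω) ^ 2)
      = fun ω => (w ω * (u ω * u ω) - 2 * ∑ j, a j * (w ω * (u ω * Z ω j)))
        + ∑ i, ∑ j, a i * a j * (w ω * (Z ω i * Z ω j)) := by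
    funext ω
    have h1 : ∑ j, a j * (w ω * (u ω * Z ω j)) = w ω * u ω * (a ⬝ᵥ Z ω) := by
      simp only [dotProduct, Finset.mul_sum]
      exact Finset.sum_congr rfl fun j _ => by ring
    have h2 : ∑ i, ∑ j, a i * a j * (w ω * (Z ω i * Z ω j))
        = w ω * ((a ⬝ᵥ Z ω) * (a ⬝ᵥ Z ω)) := by
      simp only [dotProduct]
      rw [Finset.sum_mul_sum]
      simp only [Finset.mul_sum]
      exact Finset.sum_congr rfl fun i _ => Finset.sum_congr rfl fun j _ => by ring
    rw [h1, h2]; ring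
  rw [e]
  refine ⟨(i1.sub (s2.const_mul _)).add s3, ?_⟩
  have j1 : Integrable (fun ω => w ω * (u ω * u ω) - 2 * ∑ j, a j * (w ω * (u ω * Z ω j))) P :=
    i1.sub (s2.const_mul _)
  rw [integral_add j1 s3, integral_sub i1 (s2.const_mul _),
    integral_const_mul, integral_finsetSum _ fun j _ => (i2 j).const_mul _,
    integral_finsetSum _ fun i _ => s3' i]
  simp_rw [integral_const_mul]
  congr 1
  refine Finset.sum_congr rfl fun i _ => ?_
  rw [integral_finsetSum _ fun j _ => (i3 i j).const_mul _]
  simp_rw [integral_const_mul]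

lemma aux_L4 {Ω : Type*} {mΩ : MeasurableSpace Ω} (P : Measure Ω) {n : ℕ}
    {Y : Ω → Fin n → ℝ} (hY : Measurable Y)
    (hi : Integrable (fun ω => Real.sqrt (∑ k, Y ω k ^ 2) ^ 4) P) (k : Fin n) :
    MemLp (fun ω => Y ω k) 4 P := by
  have hm : Measurable fun ω => Y ω k := (measurable_pi_apply k).comp hY
  rw [← integrable_norm_rpow_iff hm.aestronglyMeasurable (by norm_num) (by norm_num)]
  refine hi.mono' (hm.norm.pow_const _).aestronglyMeasurable (Filter.Eventually.of_forall fun ω => ?_)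
  have e : (4 : ENNReal).toReal = ((4 : ℕ) : ℝ) := by norm_num
  rw [e, Real.rpow_natCast, norm_pow, norm_norm]
  gcongr
  rw [Real.norm_eq_abs]
  apply Real.abs_le_sqrt
  exact Finset.single_le_sum (f := fun k => Y ω k ^ 2) (fun i _ => sq_nonneg _) (Finset.mem_univ k)

lemma aux_mul {Ω : Type*} {mΩ : MeasurableSpace Ω} (P : Measure Ω) {f g : Ω → ℝ}
    (hf : MemLp f 4 P) (hg : MemLp g 4 P) : MemLp (fun ω => f ω * g ω) 2 P := by
  have : ENNReal.HolderTriple 4 4 2 := ⟨by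
    have : (4 : ENNReal) = 2 * 2 := by norm_num
    rw [this, ENNReal.mul_inv (by norm_num) (by norm_num), ← mul_add, ENNReal.inv_two_add_inv_two,
      mul_one]⟩
  exact hg.mul' hf

lemma aux_final {f2 fR2 c K d : ℝ} (hc : 0 < c) (hd : 0 < d) {r2 : ℝ}
    (hf : c ^ 2 * d ^ 2 ≤ f2) (hr : r2 ≤ K * d ^ 4) (hr0 : 0 ≤ r2)
    (hdiff : |f2 - fR2| ≤ 2 * (Real.sqrt f2 * Real.sqrt r2) + r2)
    (hK : 0 ≤ K) (hsmall : Real.sqrt K * d ≤ c / 6) :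
    0 < fR2 ∧ |f2 - fR2| / fR2 ≤ 6 / c * Real.sqrt K * d := by
  have hf0 : 0 < f2 := lt_of_lt_of_le (by positivity) hf
  set ρ := Real.sqrt K * d / c with hρ
  have hρ0 : 0 ≤ ρ := by positivity
  have hρ6 : ρ ≤ 1 / 6 := by
    rw [hρ, div_le_iff₀ hc]; linarith
  have hKd : K * d ^ 4 = ρ ^ 2 * (c ^ 2 * d ^ 2) := by
    rw [hρ, div_pow, mul_pow, Real.sq_sqrt hK]; field_simp
  have hr' : r2 ≤ ρ ^ 2 * f2 := by
    calc r2 ≤ _ := hr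
      _ = _ := hKd
      _ ≤ _ := by gcongr
  have hs : Real.sqrt f2 * Real.sqrt r2 ≤ ρ * f2 := by
    rw [← Real.sqrt_mul hf0.le]
    apply Real.sqrt_le_iff.2 ⟨by positivity, ?_⟩
    nlinarith
  have h3 : |f2 - fR2| ≤ 3 * ρ * f2 := by
    have : ρ ^ 2 * f2 ≤ ρ * f2 := by
      gcongr; nlinarith
    linarith
  have h4 : f2 / 2 ≤ fR2 := by
    have := (abs_le.1 h3).2
    nlinarith
  have h5 : 0 < fR2 := by linarith
  refine ⟨h5, ?_⟩
  rw [div_le_iff₀ h5]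
  have : 6 / c * Real.sqrt K * d = 6 * ρ := by rw [hρ]; ring
  rw [this]
  nlinarith

lemma aux_diff {Ω : Type*} {mΩ : MeasurableSpace Ω} (P : Measure Ω) {F R : Ω → ℝ}
    (hF : MemLp F 2 P) (hR : MemLp R 2 P) :
    |(∫ ω, F ω ^ 2 ∂P) - ∫ ω, (F ω + R ω) ^ 2 ∂P|
      ≤ 2 * (Real.sqrt (∫ ω, F ω ^ 2 ∂P) * Real.sqrt (∫ ω, R ω ^ 2 ∂P)) + ∫ ω, R ω ^ 2 ∂P := by
  have hFR : Integrable (fun ω => F ω * R ω) P := hF.integrable_mul hR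
  have e : ∫ ω, (F ω + R ω) ^ 2 ∂P
      = (∫ ω, F ω ^ 2 ∂P) + 2 * (∫ ω, F ω * R ω ∂P) + ∫ ω, R ω ^ 2 ∂P := by
    have e1 : (fun ω => (F ω + R ω) ^ 2)
        = fun ω => (F ω ^ 2 + 2 * (F ω * R ω)) + R ω ^ 2 := by funext ω; ring
    have j1 : Integrable (fun ω => F ω ^ 2 + 2 * (F ω * R ω)) P :=
      hF.integrable_sq.add (hFR.const_mul _)
    rw [e1, integral_add j1 hR.integrable_sq,
      integral_add hF.integrable_sq (hFR.const_mul _), integral_const_mul]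
  have hc := abs_le.1 (aux_cs P hF hR)
  have h0 : 0 ≤ ∫ ω, R ω ^ 2 ∂P := integral_nonneg fun ω => sq_nonneg _
  rw [e, abs_le]
  constructor <;> linarith [hc.1, hc.2]

/-- **Theorem 2 of the paper.** Under the local-alternatives setup with
the smoothness-of-`μ` assumption, there exist constants `C > 0` and `δ' > 0` such that
for all `0 ≤ δκ, δβ < δ'` with `δβ > 0`: the matrix `E[w·Z·Zᵀ]` is invertible,
`f_R² > 0`, and the relative error satisfies `|f² − f_R²| / f_R² ≤ C·√K·δβ`. -/
theorem relative_error_R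
    {Ω : Type*} {mΩ : MeasurableSpace Ω} (P : Measure Ω) [IsProbabilityMeasure P]
    {p q : ℕ} (X : Ω → Fin p → ℝ) (Z0 : Ω → Fin q → ℝ)
    (hX_meas : Measurable X) (hZ0_meas : Measurable Z0)
    -- Z = (1, Z₀)
    (Z : Ω → Fin (q + 1) → ℝ) (hZ : ∀ ω, Z ω = Fin.cons 1 (Z0 ω))
    (μs : ℝ) (κs : Fin q → ℝ) (βs : Fin p → ℝ)
    -- inverse link and variance function
    (h V : ℝ → ℝ) (hh : ContDiff ℝ 1 h) (hV_cont : Continuous V)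
    (hV_pos : ∀ t, 0 < V t)
    -- linear predictor and weight, as functions of (ι, δκ, δβ)
    (η : ℝ → ℝ → ℝ → Ω → ℝ)
    (hη_def : ∀ i dκ dβ ω, η i dκ dβ ω = i + dκ * (κs ⬝ᵥ Z0 ω) + dβ * (βs ⬝ᵥ X ω))
    (w : ℝ → ℝ → ℝ → Ω → ℝ)
    (hw_def : ∀ i dκ dβ ω, w i dκ dβ ω
      = (deriv h (η i dκ dβ ω)) ^ 2 / V (h (η i dκ dβ ω)))
    (ηs : ℝ) (hηs : h ηs = μs)
    (ws : ℝ) (hws : ws = (deriv h ηs) ^ 2 / V μs)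
    -- bounded moments up to fourth order
    (hmom : ∀ i j : ℕ, 1 ≤ i + j → i + j ≤ 4 → Integrable (fun ω =>
      Real.sqrt (∑ k, X ω k ^ 2) ^ i * Real.sqrt (∑ k, Z ω k ^ 2) ^ j) P)
    -- regularity
    (hws_ne : ws ≠ 0)
    (Mzzs : Matrix (Fin (q + 1)) (Fin (q + 1)) ℝ)
    (hMzzs : Mzzs = Matrix.of fun i j => ∫ ω, ws * Z ω i * Z ω j ∂P)
    (hMzzs_inv : IsUnit Mzzs)
    (As : Matrix (Fin p) (Fin (q + 1)) ℝ)
    (hAs : As = (Matrix.of fun i j => ∫ ω, ws * X ω i * Z ω j ∂P) * Mzzs⁻¹)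
    (hreg : 0 < ∫ ω, ws * (βs ⬝ᵥ (X ω - As *ᵥ Z ω)) ^ 2 ∂P)
    -- mean constraint
    (ι : ℝ → ℝ → ℝ) (δ₀ : ℝ) (hδ₀ : 0 < δ₀)
    (hmean : ∀ dκ dβ : ℝ, 0 ≤ dκ → dκ < δ₀ → 0 ≤ dβ → dβ < δ₀ →
      ∫ ω, h (η (ι dκ dβ) dκ dβ ω) ∂P = μs)
    -- smoothness of w
    (M δstar : ℝ) (hM : 0 ≤ M) (hδstar : 0 < δstar)
    (hsmooth : ∀ dκ dβ : ℝ, 0 ≤ dκ → dκ < δstar → 0 ≤ dβ → dβ < δstar →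
      Integrable (fun ω => (w (ι dκ dβ) dκ dβ ω - ws) ^ 2) P ∧
      ∫ ω, (w (ι dκ dβ) dκ dβ ω - ws) ^ 2 ∂P ≤ M * (dκ + dβ) ^ 2)
    -- derived quantities (for parameter values where E[w·Z·Zᵀ] is invertible)
    (Mzz : ℝ → ℝ → ℝ → Matrix (Fin (q + 1)) (Fin (q + 1)) ℝ)
    (hMzz : ∀ i dκ dβ, Mzz i dκ dβ
      = Matrix.of fun k j => ∫ ω, w i dκ dβ ω * Z ω k * Z ω j ∂P)
    (A : ℝ → ℝ → ℝ → Matrix (Fin p) (Fin (q + 1)) ℝ)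
    (hA : ∀ i dκ dβ, A i dκ dβ
      = (Matrix.of fun k j => ∫ ω, w i dκ dβ ω * X ω k * Z ω j ∂P) * (Mzz i dκ dβ)⁻¹)
    (ηz : ℝ → ℝ → ℝ → Ω → ℝ)
    (hηz : ∀ i dκ dβ ω, ηz i dκ dβ ω
      = (fun j => ∫ ω', w i dκ dβ ω' * η i dκ dβ ω' * Z ω' j ∂P)
          ⬝ᵥ ((Mzz i dκ dβ)⁻¹ *ᵥ Z ω))
    (fsq : ℝ → ℝ → ℝ → ℝ)
    (hfsq : ∀ i dκ dβ, fsq i dκ dβ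
      = ∫ ω, w i dκ dβ ω * (η i dκ dβ ω - ηz i dκ dβ ω) ^ 2 ∂P)
    (fφsq : ℝ → ℝ → ℝ → ℝ)
    (hfφsq : ∀ i dκ dβ, fφsq i dκ dβ
      = ws * variance (fun ω => η i dκ dβ ω - ηz i dκ dβ ω) P)
    -- outcome-scale quantities
    (μz : ℝ → ℝ → ℝ → Ω → ℝ)
    (hμz : ∀ i dκ dβ ω, μz i dκ dβ ω = h (ηz i dκ dβ ω))
    (Rem : ℝ → ℝ → ℝ → Ω → ℝ)
    (hRem : ∀ i dκ dβ ω, Rem i dκ dβ ω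
      = μz i dκ dβ ω - h (η i dκ dβ ω)
        - deriv h (η i dκ dβ ω) * (ηz i dκ dβ ω - η i dκ dβ ω))
    (fRsq : ℝ → ℝ → ℝ → ℝ)
    (hfRsq : ∀ i dκ dβ, fRsq i dκ dβ
      = ∫ ω, (h (η i dκ dβ ω) - μz i dκ dβ ω) ^ 2 / V (h (η i dκ dβ ω)) ∂P)
    -- smoothness of μ
    (K δstar2 : ℝ) (hK : 0 ≤ K) (hδstar2 : 0 < δstar2)
    (hsmooth_mu : ∀ dκ dβ : ℝ, 0 ≤ dκ → dκ < δstar2 → 0 ≤ dβ → dβ < δstar2 →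
      Integrable (fun ω =>
        Rem (ι dκ dβ) dκ dβ ω ^ 2 / V (h (η (ι dκ dβ) dκ dβ ω))) P ∧
      ∫ ω, Rem (ι dκ dβ) dκ dβ ω ^ 2 / V (h (η (ι dκ dβ) dκ dβ ω)) ∂P
        ≤ K * dβ ^ 4) :
    ∃ C > (0 : ℝ), ∃ δ' > (0 : ℝ), ∀ dκ dβ : ℝ, 0 ≤ dκ → dκ < δ' → 0 ≤ dβ → dβ < δ' →
      0 < dβ →
      IsUnit (Mzz (ι dκ dβ) dκ dβ) ∧
      0 < fRsq (ι dκ dβ) dκ dβ ∧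
      |fsq (ι dκ dβ) dκ dβ - fRsq (ι dκ dβ) dκ dβ| / fRsq (ι dκ dβ) dκ dβ
        ≤ C * Real.sqrt K * dβ := by
  classical
  -- measurability
  have hZ_meas : Measurable Z := by
    have : Z = fun ω => Fin.cons 1 (Z0 ω) := funext hZ
    rw [this]
    refine measurable_pi_iff.2 fun i => ?_
    refine Fin.cases ?_ (fun j => ?_) i
    · simp
    · simp only [Fin.cons_succ]
      exact (measurable_pi_apply j).comp hZ0_meas
  have hX_k : ∀ k, Measurable fun ω => X ω k := fun k => (measurable_pi_apply k).comp hX_meas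
  have hZ_k : ∀ k, Measurable fun ω => Z ω k := fun k => (measurable_pi_apply k).comp hZ_meas
  have hZ0_k : ∀ k, Measurable fun ω => Z0 ω k := fun k => (measurable_pi_apply k).comp hZ0_meas
  have hh_m : Measurable h := hh.continuous.measurable
  have hdh_m : Measurable (deriv h) := measurable_deriv h
  have hV_m : Measurable V := hV_cont.measurable
  have hη_m : ∀ i a b, Measurable (η i a b) := by
    intro i a b
    have : η i a b = fun ω => i + a * (κs ⬝ᵥ Z0 ω) + b * (βs ⬝ᵥ X ω) := funext (hη_def i a b)
    rw [this]; simp only [dotProduct]; fun_prop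
  have hw_m : ∀ i a b, Measurable (w i a b) := by
    intro i a b
    have : w i a b = fun ω => (deriv h (η i a b ω)) ^ 2 / V (h (η i a b ω)) := funext (hw_def i a b)
    have := hη_m i a b
    rw [‹w i a b = _›]; fun_prop
  have hηz_m : ∀ i a b, Measurable (ηz i a b) := by
    intro i a b
    rw [show ηz i a b = _ from funext (hηz i a b)]
    simp only [dotProduct, mulVec]; fun_prop
  -- moments
  have hX4 : ∀ k, MemLp (fun ω => X ω k) 4 P := fun k =>
    aux_L4 P hX_meas (by simpa using hmom 4 0 (by norm_num) (by norm_num)) k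
  have hZ4 : ∀ k, MemLp (fun ω => Z ω k) 4 P := fun k =>
    aux_L4 P hZ_meas (by simpa using hmom 0 4 (by norm_num) (by norm_num)) k
  set u : Ω → ℝ := fun ω => βs ⬝ᵥ X ω with hu
  have hu4 : MemLp u 4 P := by
    simp only [hu, dotProduct]
    exact memLp_finsetSum _ fun k _ => (hX4 k).const_mul _
  have huu := aux_mul P hu4 hu4
  have huZ := fun j => aux_mul P hu4 (hZ4 j)
  have hZZ := fun i j => aux_mul P (hZ4 i) (hZ4 j)
  have hXZ := fun i j => aux_mul P (hX4 i) (hZ4 j)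
  -- filter
  set S : Set (ℝ × ℝ) := {d | 0 ≤ d.1 ∧ 0 ≤ d.2} with hS
  set l : Filter (ℝ × ℝ) := nhdsWithin (0, 0) S with hl
  set W : ℝ × ℝ → Ω → ℝ := fun d => w (ι d.1 d.2) d.1 d.2 with hW
  have ev : ∀ δ > (0 : ℝ), ∀ᶠ d in l, (0 ≤ d.1 ∧ 0 ≤ d.2) ∧ d.1 < δ ∧ d.2 < δ := by
    intro δ hδ
    have h1 : ∀ᶠ d in l, d ∈ S := eventually_mem_nhdsWithin
    have h2 : ∀ᶠ d : ℝ × ℝ in l, d.1 < δ ∧ d.2 < δ := by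
      apply Filter.Eventually.filter_mono nhdsWithin_le_nhds
      exact ((continuous_fst.tendsto ((0, 0) : ℝ × ℝ)).eventually_lt_const hδ).and
        ((continuous_snd.tendsto ((0, 0) : ℝ × ℝ)).eventually_lt_const hδ)
    exact h1.and h2
  have hWs : ∀ a b : ℝ, 0 ≤ a → a < δstar → 0 ≤ b → b < δstar →
      MemLp (fun ω => W (a, b) ω - ws) 2 P := by
    intro a b ha ha' hb hb'
    rw [memLp_two_iff_integrable_sq ((hw_m _ _ _).sub_const _).aestronglyMeasurable]
    exact (hsmooth a b ha ha' hb hb').1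
  have hW2 : ∀ a b : ℝ, 0 ≤ a → a < δstar → 0 ≤ b → b < δstar → MemLp (W (a, b)) 2 P := by
    intro a b ha ha' hb hb'
    have := (hWs a b ha ha' hb hb').add (memLp_const ws)
    convert this using 1
    funext ω; simp
  have hws2 : MemLp (fun _ : Ω => ws) 2 P := memLp_const ws
  have lim : ∀ g : Ω → ℝ, MemLp g 2 P →
      Filter.Tendsto (fun d => ∫ ω, W d ω * g ω ∂P) l (nhds (∫ ω, ws * g ω ∂P)) := by
    intro g hg
    rw [tendsto_iff_dist_tendsto_zero]
    have hb : Filter.Tendsto (fun d : ℝ × ℝ => Real.sqrt (M * (d.1 + d.2) ^ 2)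
        * Real.sqrt (∫ ω, g ω ^ 2 ∂P)) l (nhds 0) := by
      have : Continuous (fun d : ℝ × ℝ => Real.sqrt (M * (d.1 + d.2) ^ 2)
        * Real.sqrt (∫ ω, g ω ^ 2 ∂P)) := by fun_prop
      have := (this.tendsto (0, 0)).mono_left (nhdsWithin_le_nhds (s := S))
      simpa using this
    refine squeeze_zero' (Filter.Eventually.of_forall fun _ => dist_nonneg) ?_ hb
    filter_upwards [ev δstar hδstar] with d hd
    obtain ⟨⟨h1, h2⟩, h3, h4⟩ := hd
    have e : (∫ ω, W d ω * g ω ∂P) - ∫ ω, ws * g ω ∂P = ∫ ω, (W d ω - ws) * g ω ∂P := by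
      have j1 : Integrable (fun ω => W d ω * g ω) P :=
        (hW2 d.1 d.2 h1 h3 h2 h4).integrable_mul hg
      have j2 : Integrable (fun ω => ws * g ω) P := hws2.integrable_mul hg
      rw [← integral_sub j1 j2]
      congr 1; funext ω; ring
    rw [Real.dist_eq, e]
    refine (aux_cs P (hWs d.1 d.2 h1 h3 h2 h4) hg).trans ?_
    gcongr
    exact (hsmooth d.1 d.2 h1 h3 h2 h4).2
  -- limits of matrices
  set MM : ℝ × ℝ → Matrix (Fin (q + 1)) (Fin (q + 1)) ℝ :=
    fun d => Mzz (ι d.1 d.2) d.1 d.2 with hMM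
  have hMM_e : ∀ d i j, MM d i j = ∫ ω, W d ω * (Z ω i * Z ω j) ∂P := by
    intro d i j; simp only [hMM, hMzz, hW, of_apply, mul_assoc]
  have hMs_e : ∀ i j, Mzzs i j = ∫ ω, ws * (Z ω i * Z ω j) ∂P := by
    intro i j; simp only [hMzzs, of_apply, mul_assoc]
  have limM : Filter.Tendsto MM l (nhds Mzzs) := by
    refine tendsto_pi_nhds.2 fun i => tendsto_pi_nhds.2 fun j => ?_
    simp only [hMM_e, hMs_e]
    exact lim _ (hZZ i j)
  have limdet : Filter.Tendsto (fun d => (MM d).det) l (nhds Mzzs.det) :=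
    ((Continuous.matrix_det continuous_id).tendsto Mzzs).comp limM
  have hdet : Mzzs.det ≠ 0 := by
    have := (Matrix.isUnit_iff_isUnit_det _).1 hMzzs_inv
    exact this.ne_zero
  have limInv : Filter.Tendsto (fun d => (MM d)⁻¹) l (nhds Mzzs⁻¹) := by
    simp only [Matrix.inv_def, Ring.inverse_eq_inv']
    exact (limdet.inv₀ hdet).smul
      (((Continuous.matrix_adjugate continuous_id).tendsto Mzzs).comp limM)
  have evdet : ∀ᶠ d in l, (MM d).det ≠ 0 := limdet.eventually_ne hdet
  set b : ℝ × ℝ → Fin (q + 1) → ℝ := fun d j => ∫ ω, W d ω * (u ω * Z ω j) ∂P with hb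
  set bs : Fin (q + 1) → ℝ := fun j => ∫ ω, ws * (u ω * Z ω j) ∂P with hbs
  have limb : Filter.Tendsto b l (nhds bs) :=
    tendsto_pi_nhds.2 fun j => lim _ (huZ j)
  set a : ℝ × ℝ → Fin (q + 1) → ℝ := fun d => b d ᵥ* (MM d)⁻¹ with ha
  set as : Fin (q + 1) → ℝ := bs ᵥ* Mzzs⁻¹ with has
  have lima : Filter.Tendsto a l (nhds as) := by
    refine tendsto_pi_nhds.2 fun j => ?_
    simp only [ha, has, vecMul, dotProduct]
    refine tendsto_finsetSum _ fun i _ => ?_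
    exact (tendsto_pi_nhds.1 limb i).mul (tendsto_pi_nhds.1 (tendsto_pi_nhds.1 limInv i) j)
  have limQ : Filter.Tendsto (fun d => ∫ ω, W d ω * (u ω - a d ⬝ᵥ Z ω) ^ 2 ∂P) l
      (nhds (∫ ω, ws * (u ω - as ⬝ᵥ Z ω) ^ 2 ∂P)) := by
    rw [(aux_quad P hws2 huu huZ hZZ as).2]
    have : Filter.Tendsto (fun d => (∫ ω, W d ω * (u ω * u ω) ∂P)
        - 2 * (∑ j, a d j * ∫ ω, W d ω * (u ω * Z ω j) ∂P)
        + ∑ i, ∑ j, a d i * a d j * ∫ ω, W d ω * (Z ω i * Z ω j) ∂P) l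
      (nhds ((∫ ω, ws * (u ω * u ω) ∂P)
        - 2 * (∑ j, as j * ∫ ω, ws * (u ω * Z ω j) ∂P)
        + ∑ i, ∑ j, as i * as j * ∫ ω, ws * (Z ω i * Z ω j) ∂P)) := by
      have la := tendsto_pi_nhds.1 lima
      refine ((lim _ huu).sub ((tendsto_finsetSum _ fun j _ =>
        (la j).mul (lim _ (huZ j))).const_mul 2)).add
        (tendsto_finsetSum _ fun i _ => tendsto_finsetSum _ fun j _ =>
          ((la i).mul (la j)).mul (lim _ (hZZ i j)))
    refine this.congr' ?_
    filter_upwards [ev δstar hδstar] with d hd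
    obtain ⟨⟨h1, h2⟩, h3, h4⟩ := hd
    exact (aux_quad P (hW2 d.1 d.2 h1 h3 h2 h4) huu huZ hZZ (a d)).2.symm
  -- identify the limit
  have hsEq : ∀ ω, βs ⬝ᵥ (X ω - As *ᵥ Z ω) = u ω - as ⬝ᵥ Z ω := by
    intro ω
    rw [dotProduct_sub, dotProduct_mulVec, hAs, ← vecMul_vecMul]
    have : βs ᵥ* (Matrix.of fun i j => ∫ ω, ws * X ω i * Z ω j ∂P) = bs := by
      funext j
      simp only [vecMul, dotProduct, hbs, hu, of_apply]
      rw [show (fun ω => ws * ((∑ i, βs i * X ω i) * Z ω j))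
        = fun ω => ∑ i, βs i * (ws * (X ω i * Z ω j)) from by
          funext ω; rw [Finset.sum_mul, Finset.mul_sum]
          exact Finset.sum_congr rfl fun i _ => by ring]
      have j1 : ∀ i, Integrable (fun ω => βs i * (ws * (X ω i * Z ω j))) P := fun i =>
        (hws2.integrable_mul (hXZ i j)).const_mul _
      rw [integral_finsetSum _ fun i _ => j1 i]
      refine Finset.sum_congr rfl fun i _ => ?_
      rw [integral_const_mul]
      simp only [mul_assoc]
    rw [this]
  set L := ∫ ω, ws * (u ω - as ⬝ᵥ Z ω) ^ 2 ∂P with hL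
  have hL0 : 0 < L := by
    simpa only [hsEq] using hreg
  have evQ : ∀ᶠ d in l, L / 2 < ∫ ω, W d ω * (u ω - a d ⬝ᵥ Z ω) ^ 2 ∂P :=
    limQ.eventually_const_lt (by linarith)
  set c := Real.sqrt (L / 2) with hc
  have hc0 : 0 < c := Real.sqrt_pos.2 (by linarith)
  have hc2 : c ^ 2 = L / 2 := Real.sq_sqrt (by linarith)
  have evK : ∀ᶠ d : ℝ × ℝ in l, Real.sqrt K * d.2 < c / 6 := by
    apply Filter.Eventually.filter_mono nhdsWithin_le_nhds
    have hcont : Continuous fun d : ℝ × ℝ => Real.sqrt K * d.2 := by fun_prop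
    exact (hcont.tendsto (0, 0)).eventually_lt_const (by simp; positivity)
  have evAll := (ev δstar hδstar).and ((ev δstar2 hδstar2).and (evdet.and (evQ.and evK)))
  -- extract δ'
  obtain ⟨δ', hδ', hall⟩ : ∃ δ' > (0 : ℝ), ∀ x y : ℝ, 0 ≤ x → x < δ' → 0 ≤ y → y < δ' →
      ((0 ≤ x ∧ 0 ≤ y) ∧ x < δstar ∧ y < δstar) ∧ ((0 ≤ x ∧ 0 ≤ y) ∧ x < δstar2 ∧ y < δstar2) ∧
      (MM (x, y)).det ≠ 0 ∧ L / 2 < (∫ ω, W (x, y) ω * (u ω - a (x, y) ⬝ᵥ Z ω) ^ 2 ∂P) ∧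
      Real.sqrt K * y < c / 6 := by
    rw [hl, Filter.Eventually, Metric.mem_nhdsWithin_iff] at evAll
    obtain ⟨δ', hδ', hsub⟩ := evAll
    refine ⟨δ', hδ', fun x y hx hx' hy hy' => ?_⟩
    have := @hsub (x, y) ⟨by
      rw [Metric.mem_ball, Prod.dist_eq]
      simp [abs_of_nonneg hx, abs_of_nonneg hy, hx', hy'], ⟨hx, hy⟩⟩
    exact this
  refine ⟨6 / c, by positivity, δ', hδ', ?_⟩
  intro x y hx hx' hy hy' hy0
  obtain ⟨⟨_, hxs, hys⟩, ⟨_, hxs2, hys2⟩, hdetxy, hQ, hKy⟩ := hall x y hx hx' hy hy'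
  have hU : IsUnit (MM (x, y)).det := isUnit_iff_ne_zero.2 hdetxy
  refine ⟨(Matrix.isUnit_iff_isUnit_det _).2 hU, ?_⟩
  set i := ι x y with hi
  have hWxy : W (x, y) = w i x y := rfl
  have hMxy : MM (x, y) = Mzz i x y := rfl
  have hw2 : MemLp (w i x y) 2 P := hW2 x y hx hxs hy hys
  -- η - ηz
  set cc : Fin (q + 1) → ℝ := Fin.cons i (x • κs) with hcc
  have hηcc : ∀ ω, η i x y ω = cc ⬝ᵥ Z ω + y * u ω := by
    intro ω
    rw [hη_def, hZ, hcc]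
    simp [dotProduct, Fin.sum_univ_succ, hu, Finset.mul_sum, mul_assoc]
  have hvec : (fun j => ∫ ω', w i x y ω' * η i x y ω' * Z ω' j ∂P)
      = cc ᵥ* MM (x, y) + y • b (x, y) := by
    funext j
    have e : (fun ω' => w i x y ω' * η i x y ω' * Z ω' j)
        = fun ω' => (∑ k, cc k * (w i x y ω' * (Z ω' k * Z ω' j)))
          + y * (w i x y ω' * (u ω' * Z ω' j)) := by
      funext ω
      rw [hηcc]
      have : ∑ k, cc k * (w i x y ω * (Z ω k * Z ω j)) = w i x y ω * (cc ⬝ᵥ Z ω) * Z ω j := by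
        simp only [dotProduct, Finset.mul_sum, Finset.sum_mul]
        exact Finset.sum_congr rfl fun k _ => by ring
      rw [this]; ring
    have ik : ∀ k, Integrable (fun ω' => cc k * (w i x y ω' * (Z ω' k * Z ω' j))) P :=
      fun k => (hw2.integrable_mul (hZZ k j)).const_mul _
    have iu : Integrable (fun ω' => y * (w i x y ω' * (u ω' * Z ω' j))) P :=
      (hw2.integrable_mul (huZ j)).const_mul _
    rw [e, integral_add (integrable_finsetSum _ fun k _ => ik k) iu,
      integral_finsetSum _ fun k _ => ik k, integral_const_mul]
    simp_rw [integral_const_mul]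
    simp only [Pi.add_apply, Pi.smul_apply, smul_eq_mul, vecMul, dotProduct, hMM_e, hb, hWxy]
  have hdiffη : ∀ ω, η i x y ω - ηz i x y ω = y * (u ω - a (x, y) ⬝ᵥ Z ω) := by
    intro ω
    rw [hηz, hvec, ← hMxy, dotProduct_mulVec, add_vecMul, vecMul_vecMul,
      Matrix.mul_nonsing_inv _ hU, vecMul_one, smul_vecMul, add_dotProduct, smul_dotProduct, hηcc,
      smul_eq_mul]
    simp only [ha]
    ring
  have quad := aux_quad P hw2 huu huZ hZZ (a (x, y))
  have hfun : (fun ω => w i x y ω * (η i x y ω - ηz i x y ω) ^ 2)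
      = fun ω => y ^ 2 * (w i x y ω * (u ω - a (x, y) ⬝ᵥ Z ω) ^ 2) := by
    funext ω; rw [hdiffη]; ring
  have hint : Integrable (fun ω => w i x y ω * (η i x y ω - ηz i x y ω) ^ 2) P := by
    rw [hfun]; exact quad.1.const_mul _
  have hf2 : c ^ 2 * y ^ 2 ≤ fsq i x y := by
    rw [hfsq, hfun, integral_const_mul, hc2, mul_comm]
    rw [hWxy] at hQ
    gcongr
  -- F, R
  have hsV : ∀ ω, Real.sqrt (V (h (η i x y ω))) ^ 2 = V (h (η i x y ω)) :=
    fun ω => Real.sq_sqrt (hV_pos _).le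
  set F : Ω → ℝ := fun ω => deriv h (η i x y ω) * (ηz i x y ω - η i x y ω)
    / Real.sqrt (V (h (η i x y ω))) with hF
  set R : Ω → ℝ := fun ω => Rem i x y ω / Real.sqrt (V (h (η i x y ω))) with hR
  have hη_m' := hη_m i x y
  have hηz_m' := hηz_m i x y
  have hRem_m : Measurable (Rem i x y) := by
    rw [show Rem i x y = _ from funext (hRem i x y)]
    simp only [hμz]
    fun_prop
  have hF_m : Measurable F := by fun_prop
  have hR_m : Measurable R := by fun_prop
  have hFsq : (fun ω => F ω ^ 2) = fun ω => w i x y ω * (η i x y ω - ηz i x y ω) ^ 2 := by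
    funext ω
    simp only [hF, hw_def, div_pow, hsV]; ring
  have hRsq : (fun ω => R ω ^ 2) = fun ω => Rem i x y ω ^ 2 / V (h (η i x y ω)) := by
    funext ω
    simp only [hR, div_pow, hsV]
  have hGsq : (fun ω => (F ω + R ω) ^ 2)
      = fun ω => (h (η i x y ω) - μz i x y ω) ^ 2 / V (h (η i x y ω)) := by
    funext ω
    simp only [hF, hR, ← add_div, div_pow, hsV, hRem]; ring
  have hsm := hsmooth_mu x y hx hxs2 hy hys2
  have hF2 : MemLp F 2 P := by
    rw [memLp_two_iff_integrable_sq hF_m.aestronglyMeasurable, hFsq]; exact hint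
  have hR2 : MemLp R 2 P := by
    rw [memLp_two_iff_integrable_sq hR_m.aestronglyMeasurable, hRsq]; exact hsm.1
  have hd := aux_diff P hF2 hR2
  rw [hGsq, ← hfRsq, hFsq, ← hfsq] at hd
  refine aux_final hc0 hy0 hf2 ?_ (integral_nonneg fun ω => sq_nonneg (R ω)) hd hK hKy.le
  rw [hRsq]; exact hsm.2
end
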